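/- Let K be a field, S = K[x,y,z,w], and I ⊆ S a monomial ideal such that Ass(S/I) = {(x,y), (x,z)}. Then S/I is clean. -/

import Mathlib

open MvPolynomial

/-- The depth of an `S`-module `M` with respect to an ideal `m`: the supremum of
lengths of `M`-regular sequences consisting of elements of `m`. -/
noncomputable def mDepth (S : Type*) [CommRing S] (m : Ideal S)
    (M : Type*) [AddCommGroup M] [Module S M] : ℕ∞ :=
  sSup {n : ℕ∞ | ∃ rs : List S, (rs.length : ℕ∞) = n ∧ (∀ r ∈ rs, r ∈ m) ∧
    RingTheory.Sequence.IsRegular M rs}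

/-- `M` is a Cohen–Macaulay `S`-module (w.r.t. the ideal `m`) if its depth with
respect to `m` equals its Krull dimension, i.e. the Krull dimension of `S ⧸ ann M`. -/
def IsCM (S : Type*) [CommRing S] (m : Ideal S)
    (M : Type*) [AddCommGroup M] [Module S M] : Prop :=
  (mDepth S m M : WithBot ℕ∞) = ringKrullDim (S ⧸ Module.annihilator S M)

/-- `F` is a prime filtration `I = F₀ ⊆ F₁ ⊆ ... ⊆ F_r = S` with
`F_i/F_{i-1} ≅ S/P_i` for prime ideals `P_i`. -/
def IsPrimeFiltration {S : Type*} [CommRing S] (I : Ideal S) (r : ℕ)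
    (F : Fin (r + 1) → Ideal S) (P : Fin r → Ideal S) : Prop :=
  F 0 = I ∧ F (Fin.last r) = ⊤ ∧ (∀ i : Fin r, F i.castSucc ≤ F i.succ) ∧
  ∀ i : Fin r, (P i).IsPrime ∧
    Nonempty ((↥(Submodule.map (F i.castSucc).mkQ (F i.succ))) ≃ₗ[S] (S ⧸ P i))

/-- `S/I` is clean: it has a prime filtration all of whose primes are minimal
primes of `I`. -/
def IsClean {S : Type*} [CommRing S] (I : Ideal S) : Prop :=
  ∃ (r : ℕ) (F : Fin (r + 1) → Ideal S) (P : Fin r → Ideal S),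
    IsPrimeFiltration I r F P ∧ ∀ i, P i ∈ I.minimalPrimes

/-- `S/I` is pretty clean: it has a prime filtration such that `i ≤ j` and
`P i ⊆ P j` imply `P i = P j`. -/
def IsPrettyClean {S : Type*} [CommRing S] (I : Ideal S) : Prop :=
  ∃ (r : ℕ) (F : Fin (r + 1) → Ideal S) (P : Fin r → Ideal S),
    IsPrimeFiltration I r F P ∧ ∀ i j : Fin r, i ≤ j → P i ≤ P j → P i = P j

/-- A (finitely generated) `S`-module `M` is clean: it has a filtration
`0 = M₀ ⊆ M₁ ⊆ ... ⊆ M_r = M` with `M_i/M_{i-1} ≅ S/P_i` where each `P_i` is a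
minimal prime of the support of `M`, i.e. a minimal prime over `ann M`. -/
def IsCleanModule (S : Type*) [CommRing S] (M : Type*) [AddCommGroup M] [Module S M] : Prop :=
  ∃ (r : ℕ) (F : Fin (r + 1) → Submodule S M) (P : Fin r → Ideal S),
    F 0 = ⊥ ∧ F (Fin.last r) = ⊤ ∧ (∀ i : Fin r, F i.castSucc ≤ F i.succ) ∧
    (∀ i : Fin r, (P i).IsPrime ∧
      Nonempty ((↥(F i.succ) ⧸ (Submodule.comap (F i.succ).subtype (F i.castSucc)))
        ≃ₗ[S] (S ⧸ P i))) ∧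
    ∀ i, P i ∈ (Module.annihilator S M).minimalPrimes

/-- An ideal of a polynomial ring is a monomial ideal if it is generated by monomials. -/
def IsMonomialIdeal {σ K : Type*} [CommSemiring K] (I : Ideal (MvPolynomial σ K)) : Prop :=
  ∃ G : Set (MvPolynomial σ K),
    (∀ g ∈ G, ∃ e : σ →₀ ℕ, g = MvPolynomial.monomial e 1) ∧ I = Ideal.span G

/-- The height of an ideal: the infimum of the heights of the primes containing it. -/
noncomputable def idealHeight {S : Type*} [CommRing S] (I : Ideal S) : ℕ∞ :=
  sInf {n : ℕ∞ | ∃ q : PrimeSpectrum S, I ≤ q.asIdeal ∧ Order.height q = n}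

/-- `I` can be joined to the unit ideal by a finite chain of ideals whose successive quotients are
of the form `A ⧸ P` with `P ∈ Ps`. -/
inductive HasFiltration {A : Type*} [CommRing A] (Ps : Set (Ideal A)) : Ideal A → Prop
  | top : HasFiltration Ps ⊤
  | step {I J P : Ideal A} (hle : I ≤ J) (hP : P ∈ Ps)
      (e : Nonempty (↥(Submodule.map I.mkQ J) ≃ₗ[A] (A ⧸ P))) (hJ : HasFiltration Ps J) :
      HasFiltration Ps I

theorem HasFiltration.exists_isPrimeFiltration {A : Type*} [CommRing A] {Ps : Set (Ideal A)}
    (hPs : ∀ P ∈ Ps, P.IsPrime) {I : Ideal A} (h : HasFiltration Ps I) :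
    ∃ (r : ℕ) (F : Fin (r + 1) → Ideal A) (P : Fin r → Ideal A),
      IsPrimeFiltration I r F P ∧ ∀ i, P i ∈ Ps := by
  induction h with
  | top => exact ⟨0, fun _ => ⊤, Fin.elim0, ⟨rfl, rfl, fun i => i.elim0, fun i => i.elim0⟩,
      fun i => i.elim0⟩
  | @step I J P hle hP e hJ ih =>
    obtain ⟨r, F, Q, ⟨h0, hlast, hmono, hquot⟩, hmem⟩ := ih
    refine ⟨r + 1, Fin.cons I F, Fin.cons P Q, ⟨rfl, ?_, ?_, ?_⟩, ?_⟩
    · rw [← Fin.succ_last, Fin.cons_succ, hlast]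
    · refine Fin.cases ?_ fun i => ?_
      · simpa [h0] using hle
      · simpa [← Fin.succ_castSucc] using hmono i
    · refine Fin.cases ?_ fun i => ?_
      · refine ⟨hPs P hP, ?_⟩
        rw [Fin.castSucc_zero, Fin.cons_zero, Fin.cons_succ, Fin.cons_zero, h0]
        exact e
      · rw [← Fin.succ_castSucc, Fin.cons_succ, Fin.cons_succ, Fin.cons_succ]
        exact hquot i
    · refine Fin.cases ?_ fun i => ?_
      · simpa using hP
      · simpa using hmem i

theorem nonempty_map_mkQ_sup_span_singleton_equiv {A : Type*} [CommRing A] {I P : Ideal A} (m : A)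
    (h : ∀ f, f * m ∈ I ↔ f ∈ P) :
    Nonempty (↥(Submodule.map I.mkQ (I ⊔ Ideal.span {m})) ≃ₗ[A] (A ⧸ P)) := by
  have hker : LinearMap.ker (LinearMap.toSpanSingleton A (A ⧸ I) (I.mkQ m)) = P := by
    ext f
    rw [LinearMap.mem_ker, LinearMap.toSpanSingleton_apply, ← map_smul, smul_eq_mul, ← h f,
      ← LinearMap.mem_ker, Submodule.ker_mkQ]
  have hrange : LinearMap.range (LinearMap.toSpanSingleton A (A ⧸ I) (I.mkQ m)) =
      Submodule.map I.mkQ (I ⊔ Ideal.span {m}) := by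
    rw [Submodule.map_sup, Submodule.mkQ_map_self, bot_sup_eq, Ideal.span, Submodule.map_span,
      Set.image_singleton, LinearMap.range_toSpanSingleton]
  exact ⟨((Submodule.quotEquivOfEq _ _ hker.symm).trans
    ((LinearMap.toSpanSingleton A (A ⧸ I) (I.mkQ m)).quotKerEquivRange.trans
      (LinearEquiv.ofEq _ _ hrange))).symm⟩

/-- The exponents `e` such that each `e j` is at least a bound depending on `e x`. -/
def staircase {σ : Type*} (x : σ) (b : σ → ℕ → ℕ) : Set (σ →₀ ℕ) :=
  {e | ∀ j, b j (e x) ≤ e j}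

theorem isUpperSet_staircase {σ : Type*} (x : σ) {b : σ → ℕ → ℕ} (hb : ∀ j, Antitone (b j)) :
    IsUpperSet (staircase x b) := fun _ _ hef he j =>
  (hb j (hef x)).trans ((he j).trans (hef j))

theorem MvPolynomial.mem_restrictSupportIdeal_iff {σ R : Type*} [CommSemiring R]
    {s : Set (σ →₀ ℕ)} (hs : IsUpperSet s) {f : MvPolynomial σ R} :
    f ∈ restrictSupportIdeal R s hs ↔ ∀ e ∈ f.support, e ∈ s :=
  Iff.rfl

/-- Adding to an upper set the exponents above `m` amounts to adjoining the monomial with exponent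
`m` to the corresponding monomial ideal. -/
theorem MvPolynomial.restrictSupportIdeal_sup_span_monomial {σ R : Type*} [CommRing R]
    {s t : Set (σ →₀ ℕ)} (hs : IsUpperSet s) (ht : IsUpperSet t) (m : σ →₀ ℕ)
    (h : ∀ e, e ∈ t ↔ e ∈ s ∨ m ≤ e) :
    restrictSupportIdeal R t ht = restrictSupportIdeal R s hs ⊔ Ideal.span {monomial m 1} := by
  apply le_antisymm
  · intro f hf
    rw [f.as_sum]
    refine Submodule.sum_mem _ fun e he => ?_
    rcases (h e).1 ((mem_restrictSupportIdeal_iff ht).1 hf e he) with hes | hme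
    · refine Submodule.mem_sup_left ((mem_restrictSupportIdeal_iff hs).2 fun e' he' => ?_)
      rw [Finset.mem_singleton.1 (support_monomial_subset he')]
      exact hes
    · refine Submodule.mem_sup_right (Ideal.mem_span_singleton.2 ?_)
      exact monomial_dvd_monomial.2 ⟨Or.inr hme, one_dvd _⟩
  · refine sup_le (fun f hf => ?_) ((Ideal.span_singleton_le_iff_mem _).2 ?_)
    · exact (mem_restrictSupportIdeal_iff ht).2 fun e he =>
        (h e).2 (Or.inl ((mem_restrictSupportIdeal_iff hs).1 hf e he))
    · refine (mem_restrictSupportIdeal_iff ht).2 fun e he => ?_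
      rw [Finset.mem_singleton.1 (support_monomial_subset he)]
      exact (h m).2 (Or.inr le_rfl)

theorem MvPolynomial.mul_monomial_mem_restrictSupportIdeal_iff {σ R : Type*} [CommSemiring R]
    {s : Set (σ →₀ ℕ)} (hs : IsUpperSet s) {f : MvPolynomial σ R} (m : σ →₀ ℕ) :
    f * monomial m 1 ∈ restrictSupportIdeal R s hs ↔ ∀ e ∈ f.support, e + m ∈ s := by
  rw [mem_restrictSupportIdeal_iff]
  constructor
  · intro h e he
    refine h _ ?_
    rw [mem_support_iff, coeff_mul_monomial, mul_one]
    exact mem_support_iff.1 he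
  · intro h e he
    rw [mem_support_iff, coeff_mul_monomial'] at he
    split_ifs at he with hme
    · rw [← tsub_add_cancel_of_le hme]
      exact h _ (mem_support_iff.2 (by simpa using he))
    · exact absurd rfl he

/-- Staircase ideals are filtered by the quotients by `(X x, X j)`, with `j` ranging over the
variables whose bound is not identically zero. -/
theorem hasFiltration_staircase {σ k : Type*} [Finite σ] [Field k] (x : σ)
    (Ps : Set (Ideal (MvPolynomial σ k))) (I : Ideal (MvPolynomial σ k)) (b : σ → ℕ → ℕ)
    (hb : ∀ j, Antitone (b j)) (hx : ∀ a, b x a = 0) (hN : ∃ N, ∀ j, b j N = 0)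
    (hPs : ∀ j a, b j a ≠ 0 → Ideal.span {X x, X j} ∈ Ps)
    (hI : I = restrictSupportIdeal k (staircase x b) (isUpperSet_staircase x hb)) :
    HasFiltration Ps I := by
  classical
  induction I using WellFoundedGT.induction generalizing b with
  | ind I ih =>
  obtain hN0 | ⟨a, ha⟩ : Nat.find hN = 0 ∨ ∃ a, Nat.find hN = a + 1 := by
    cases Nat.find hN <;> simp
  · have h0 := Nat.find_spec hN
    rw [hN0] at h0
    have : I = ⊤ := by
      rw [hI, eq_top_iff]
      intro f _
      refine (mem_restrictSupportIdeal_iff _).2 fun e _ j => ?_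
      have := hb j (Nat.zero_le (e x))
      rw [h0 j] at this
      omega
    rw [this]
    exact .top
  · have hsucc := Nat.find_spec hN
    rw [ha] at hsucc
    have hlt : ¬ ∀ j, b j a = 0 := Nat.find_min hN (by omega)
    push Not at hlt
    clear ha
    obtain ⟨i, hi⟩ := hlt
    have hix : i ≠ x := fun h => hi (h ▸ hx a)
    have hzero : ∀ j n, a < n → b j n = 0 := fun j n hn => by
      have := hb j (Nat.succ_le_of_lt hn)
      have := hsucc j
      simp only [Nat.succ_eq_add_one] at *
      omega
    set b' : σ → ℕ → ℕ := Function.update b i (Function.update (b i) a (b i a - 1)) with hb'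
    have hb'_ne : ∀ j n, j ≠ i → b' j n = b j n := fun j n h => by simp [hb', h]
    have hb'_ne' : ∀ n, n ≠ a → b' i n = b i n := fun n h => by simp [hb', h]
    have hb'_eq : b' i a = b i a - 1 := by simp [hb']
    have hb'_le : ∀ j n, b' j n ≤ b j n := fun j n => by
      by_cases hj : j = i
      · subst hj
        by_cases hn : n = a
        · subst hn; omega
        · exact (hb'_ne' n hn).le
      · exact (hb'_ne j n hj).le
    have hb'_anti : ∀ j, Antitone (b' j) := fun j p q hpq => by
      by_cases hj : j = i
      · subst hj
        have h1 := hb j hpq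
        by_cases hp : p = a
        · by_cases hq : q = a
          · rw [hp, hq]
          · rw [hb'_ne' q hq, hzero j q (by omega)]
            exact Nat.zero_le _
        · rw [hb'_ne' p hp]
          exact (hb'_le j q).trans h1
      · rw [hb'_ne j p hj, hb'_ne j q hj]
        exact hb j hpq
    let m : σ →₀ ℕ := Finsupp.equivFunOnFinite.symm fun j => if j = x then a else b' j a
    have hmx : m x = a := by simp [m]
    have hmj : ∀ j, j ≠ x → m j = b' j a := fun j hj => by simp [m, hj]
    have hmem : ∀ e, e ∈ staircase x b' ↔ e ∈ staircase x b ∨ m ≤ e := by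
      intro e
      constructor
      · intro he
        by_cases hea : e x = a
        · right
          intro j
          by_cases hj : j = x
          · rw [hj, hmx, hea]
          · rw [hmj j hj, ← hea]
            exact he j
        · left
          intro j
          have := he j
          by_cases hj : j = i
          · subst hj
            rwa [hb'_ne' _ hea] at this
          · rwa [hb'_ne _ _ hj] at this
      · rintro (he | he) j
        · exact (hb'_le j _).trans (he j)
        · have h1 := he x
          rw [hmx] at h1
          by_cases hj : j = x
          · have := hb'_le x (e x)
            rw [hx] at this
            rw [hj]
            omega
          · exact (hb'_anti j h1).trans ((hmj j hj).ge.trans (he j))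
    have hcolon : ∀ e : σ →₀ ℕ, e + m ∈ staircase x b ↔ e x ≠ 0 ∨ e i ≠ 0 := by
      intro e
      constructor
      · intro he
        by_contra! h
        have := he i
        rw [Finsupp.add_apply, Finsupp.add_apply, hmx, h.1, h.2, hmj i hix, hb'_eq, zero_add,
          zero_add] at this
        omega
      · intro h j
        rw [Finsupp.add_apply, Finsupp.add_apply, hmx]
        by_cases hex : e x = 0
        · by_cases hj : j = x
          · rw [hj, hx]
            exact Nat.zero_le _
          · rw [hmj j hj, hex, zero_add]
            by_cases hji : j = i
            · have := h.resolve_left (not_not.2 hex)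
              rw [hji, hb'_eq]
              omega
            · rw [hb'_ne j a hji]
              omega
        · rw [hzero j _ (by omega)]
          exact Nat.zero_le _
    have hsup := restrictSupportIdeal_sup_span_monomial (R := k) (isUpperSet_staircase x hb)
      (isUpperSet_staircase x hb'_anti) m hmem
    have hcol : ∀ f : MvPolynomial σ k, f * monomial m 1 ∈ I ↔ f ∈ Ideal.span {X x, X i} := by
      intro f
      have := mem_ideal_span_X_image (x := f) (s := {x, i})
      rw [Set.image_pair] at this
      rw [hI, mul_monomial_mem_restrictSupportIdeal_iff, this]
      simp [hcolon]
    have hle : I ≤ I ⊔ Ideal.span {monomial m 1} := le_sup_left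
    refine .step hle (hPs i a hi) (nonempty_map_mkQ_sup_span_singleton_equiv _ hcol) ?_
    refine ih _ (lt_of_le_of_ne hle fun h => ?_) b' hb'_anti (fun n => ?_) ?_ (fun j n hjn => ?_) ?_
    · have h1 : monomial m (1 : k) ∈ I := h ▸ Ideal.mem_sup_right (Ideal.mem_span_singleton_self _)
      rw [hI] at h1
      have h2 := (mem_restrictSupportIdeal_iff _).1 h1 m (by simp)
      have := (hcolon 0).1 (by simpa using h2)
      simp at this
    · exact Nat.le_zero.1 (hx n ▸ hb'_le x n)
    · obtain ⟨N, hN⟩ := hN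
      exact ⟨N, fun j => Nat.le_zero.1 (hN j ▸ hb'_le j N)⟩
    · exact hPs j n fun h => hjn (Nat.le_zero.1 (h ▸ hb'_le j n))
    · rw [hsup, hI]

theorem Ideal.minimalPrimes_subset_associatedPrimes_quotient {A : Type*} [CommRing A]
    [IsNoetherianRing A] (I : Ideal A) : I.minimalPrimes ⊆ associatedPrimes A (A ⧸ I) := by
  have := Module.associatedPrimes.minimalPrimes_annihilator_subset_associatedPrimes A (A ⧸ I)
  rwa [Ideal.annihilator_quotient] at this

theorem Ideal.mem_radical_of_forall_associatedPrimes {A : Type*} [CommRing A]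
    [IsNoetherianRing A] {I : Ideal A} {r : A} (h : ∀ P ∈ associatedPrimes A (A ⧸ I), r ∈ P) :
    r ∈ I.radical := by
  rw [← Ideal.sInf_minimalPrimes, Submodule.mem_sInf]
  exact fun P hP => h P (I.minimalPrimes_subset_associatedPrimes_quotient hP)

theorem Ideal.mem_of_mul_mem_of_forall_associatedPrimes {A : Type*} [CommRing A]
    [IsNoetherianRing A] {I : Ideal A} {r a : A}
    (h : ∀ P ∈ associatedPrimes A (A ⧸ I), r ∉ P) (hra : r * a ∈ I) : a ∈ I := by
  by_contra ha
  have hr : r ∈ {r : A | ∃ x : A ⧸ I, x ≠ 0 ∧ r • x = 0} := by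
    refine ⟨Ideal.Quotient.mk I a, fun h0 => ha (Ideal.Quotient.eq_zero_iff_mem.1 h0), ?_⟩
    exact Ideal.Quotient.eq_zero_iff_mem.2 hra
  rw [← biUnion_associatedPrimes_eq_zero_divisors] at hr
  obtain ⟨P, hP, hrP⟩ := Set.mem_iUnion₂.1 hr
  exact h P hP hrP

theorem Ideal.mem_minimalPrimes_of_associatedPrimes {A : Type*} [CommRing A]
    [IsNoetherianRing A] {I P : Ideal A} (hP : P ∈ associatedPrimes A (A ⧸ I))
    (h : ∀ Q ∈ associatedPrimes A (A ⧸ I), Q ≤ P → Q = P) : P ∈ I.minimalPrimes := by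
  have := hP.isPrime
  have hIP : I ≤ P := by
    have := IsAssociatedPrime.annihilator_le hP
    rwa [Submodule.annihilator_top, Ideal.annihilator_quotient] at this
  obtain ⟨Q, hQ, hQP⟩ := Ideal.exists_minimalPrimes_le hIP
  rwa [← h Q (I.minimalPrimes_subset_associatedPrimes_quotient hQ) hQP]

theorem IsMonomialIdeal.mem_iff {σ k : Type*} [Field k] {I : Ideal (MvPolynomial σ k)}
    (hI : IsMonomialIdeal I) (f : MvPolynomial σ k) :
    f ∈ I ↔ ∀ e ∈ f.support, monomial e (1 : k) ∈ I := by
  refine ⟨fun hf e he => ?_, fun h => ?_⟩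
  · obtain ⟨G, hG, rfl⟩ := hI
    have hGs : G = (fun s => monomial s (1 : k)) '' {s | monomial s (1 : k) ∈ G} := by
      ext g
      refine ⟨fun hg => ?_, ?_⟩
      · obtain ⟨s, rfl⟩ := hG g hg
        exact ⟨s, hg, rfl⟩
      · rintro ⟨s, hs, rfl⟩
        exact hs
    rw [hGs, mem_ideal_span_monomial_image] at hf
    obtain ⟨s, hs, hse⟩ := hf e he
    exact Ideal.mem_of_dvd _ (monomial_dvd_monomial.2 ⟨Or.inr hse, one_dvd _⟩)
      (Ideal.subset_span hs)
  · rw [f.as_sum]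
    refine Submodule.sum_mem _ fun e he => ?_
    rw [← mul_one (coeff e f), ← C_mul_monomial]
    exact I.mul_mem_left _ (h e he)

theorem MvPolynomial.X_mem_span_pair_iff {σ R : Type*} [CommSemiring R] [Nontrivial R] {i j l : σ} :
    (X l : MvPolynomial σ R) ∈ Ideal.span {X i, X j} ↔ l = i ∨ l = j := by
  classical
  have := mem_ideal_span_X_image (x := (X l : MvPolynomial σ R)) (s := {i, j})
  rw [Set.image_pair] at this
  rw [this]
  simp [support_X, Finsupp.single_apply]

/-- The exponents of an ideal whose associated primes are `(x, y)` and `(x, z)` are, in each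
`x`-degree, closed under taking minima of the exponents of `y` and `z`, and do not depend on
the exponent of `w`. -/
theorem monomial_mem_of_associatedPrimes {k : Type*} [Field k]
    {I : Ideal (MvPolynomial (Fin 4) k)}
    (hAss : associatedPrimes (MvPolynomial (Fin 4) k) (MvPolynomial (Fin 4) k ⧸ I) =
      {Ideal.span {X 0, X 1}, Ideal.span {X 0, X 2}})
    {e f g : Fin 4 →₀ ℕ} (hf : monomial f (1 : k) ∈ I) (hg : monomial g (1 : k) ∈ I)
    (hf0 : f 0 = e 0) (hg0 : g 0 = e 0) (hf1 : f 1 ≤ e 1) (hg2 : g 2 ≤ e 2) :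
    monomial e (1 : k) ∈ I := by
  have h1 : (Ideal.span {X 0, X 1} : Ideal (MvPolynomial (Fin 4) k)).IsPrime :=
    (hAss.ge (by simp)).isPrime
  have h2 : (Ideal.span {X 0, X 2} : Ideal (MvPolynomial (Fin 4) k)).IsPrime :=
    (hAss.ge (by simp)).isPrime
  refine Ideal.mem_of_mul_mem_of_forall_associatedPrimes
    (r := X 3 ^ (f 3 + g 3) * (X 1 ^ (g 1 + 1) + X 2 ^ (f 2 + 1))) ?_ ?_
  · rw [hAss]
    rintro P (rfl | rfl) hP
    · rcases h1.mem_or_mem hP with h | h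
      · simpa [X_mem_span_pair_iff] using h1.mem_of_pow_mem _ h
      · have hy := Ideal.pow_mem_of_mem _
          (X_mem_span_pair_iff (R := k) (i := (0 : Fin 4)) (j := 1).2 (Or.inr rfl)) (g 1 + 1)
          (Nat.succ_pos _)
        simpa [X_mem_span_pair_iff] using
          h1.mem_of_pow_mem _ ((Ideal.add_mem_iff_right _ hy).1 h)
    · rcases h2.mem_or_mem hP with h | h
      · simpa [X_mem_span_pair_iff] using h2.mem_of_pow_mem _ h
      · have hz := Ideal.pow_mem_of_mem _
          (X_mem_span_pair_iff (R := k) (i := (0 : Fin 4)) (j := 2).2 (Or.inr rfl)) (f 2 + 1)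
          (Nat.succ_pos _)
        simpa [X_mem_span_pair_iff] using
          h2.mem_of_pow_mem _ ((Ideal.add_mem_iff_left _ hz).1 h)
  · rw [mul_add, add_mul]
    refine I.add_mem (I.mem_of_dvd ?_ hg) (I.mem_of_dvd ?_ hf)
    all_goals
      rw [X_pow_eq_monomial, X_pow_eq_monomial, monomial_mul, monomial_mul]
      refine monomial_dvd_monomial.2 ⟨Or.inr fun j => ?_, by simp⟩
      fin_cases j <;> simp <;> omega

variable {K : Type*} [Field K]

local notation "S" => MvPolynomial (Fin 4) K
local notation "m4" => (Ideal.span {(X 0 : MvPolynomial (Fin 4) K), X 1, X 2, X 3})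

/-- If `I ⊆ K[x,y,z,w]` is a monomial ideal with
`Ass(S/I) = {(x,y), (x,z)}`, then `S/I` is clean. -/
theorem stmt_5 (I : Ideal S) (hI : IsMonomialIdeal I)
    (hAss : associatedPrimes S (S ⧸ I) =
      {Ideal.span {X 0, X 1}, Ideal.span {X 0, X 2}}) :
    IsClean I := by
  classical
  have hne : ∀ i j : Fin 4, i ≠ 0 → i ≠ j →
      ¬ (Ideal.span {X 0, X i} : Ideal S) ≤ Ideal.span {X 0, X j} := fun i j hi hij h => by
    have := X_mem_span_pair_iff.1 (h (X_mem_span_pair_iff.2 (Or.inr rfl)))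
    tauto
  have hmin : ∀ P ∈ associatedPrimes S (S ⧸ I), P ∈ I.minimalPrimes := by
    intro P hP
    refine Ideal.mem_minimalPrimes_of_associatedPrimes hP ?_
    rw [hAss] at hP ⊢
    rintro Q (rfl | rfl) hQP <;> rcases hP with rfl | rfl
    · rfl
    · exact absurd hQP (hne 1 2 (by decide) (by decide))
    · exact absurd hQP (hne 2 1 (by decide) (by decide))
    · rfl
  obtain ⟨N, hN⟩ : (X 0 : S) ∈ I.radical := by
    refine Ideal.mem_radical_of_forall_associatedPrimes ?_
    rw [hAss]
    rintro P (rfl | rfl) <;> simp [X_mem_span_pair_iff]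
  obtain ⟨M, hM⟩ : (X 1 * X 2 : S) ∈ I.radical := by
    refine Ideal.mem_radical_of_forall_associatedPrimes ?_
    rw [hAss]
    rintro P (rfl | rfl)
    · exact Ideal.mul_mem_right _ _ (X_mem_span_pair_iff.2 (Or.inr rfl))
    · exact Ideal.mul_mem_left _ _ (X_mem_span_pair_iff.2 (Or.inr rfl))
  have hup : ∀ e f : Fin 4 →₀ ℕ, e ≤ f → monomial e (1 : K) ∈ I → monomial f (1 : K) ∈ I :=
    fun e f hef he => I.mem_of_dvd (monomial_dvd_monomial.2 ⟨Or.inr hef, one_dvd _⟩) he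
  let V : Fin 4 → ℕ → Set ℕ := fun j a => {n | ∃ e, monomial e (1 : K) ∈ I ∧ e 0 = a ∧ e j = n}
  have hV : ∀ j a, (V j a).Nonempty := by
    intro j a
    refine ⟨_, Finsupp.single 0 a + (Finsupp.single 1 M + Finsupp.single 2 M), ?_, by simp, rfl⟩
    refine hup _ _ le_add_self ?_
    rwa [mul_pow, X_pow_eq_monomial, X_pow_eq_monomial, monomial_mul, mul_one] at hM
  let b : Fin 4 → ℕ → ℕ := fun j a => if j = 1 ∨ j = 2 then sInf (V j a) else 0
  have hbj : ∀ j, j = 1 ∨ j = 2 → ∀ a, b j a = sInf (V j a) := fun j hj a => if_pos hj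
  have hb0 : ∀ j, ¬ (j = 1 ∨ j = 2) → ∀ a, b j a = 0 := fun j hj a => if_neg hj
  have hb : ∀ j, Antitone (b j) := by
    intro j p q hpq
    by_cases hj : j = 1 ∨ j = 2
    · rw [hbj j hj, hbj j hj]
      obtain ⟨e, he, hep, hej⟩ := Nat.sInf_mem (hV j p)
      refine Nat.sInf_le ⟨e + Finsupp.single 0 (q - p), hup _ _ le_self_add he, ?_, ?_⟩
      · simp [hep, hpq]
      · have : (0 : Fin 4) ≠ j := by rintro rfl; simp at hj
        rw [Finsupp.add_apply, Finsupp.single_eq_of_ne' this, add_zero, hej]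
    · rw [hb0 j hj, hb0 j hj]
  have hfilt : HasFiltration (associatedPrimes S (S ⧸ I)) I := by
    refine hasFiltration_staircase 0 _ I b hb (hb0 0 (by decide)) ⟨N, fun j => ?_⟩
      (fun j a hja => ?_) ?_
    · by_cases hj : j = 1 ∨ j = 2
      · rw [hbj j hj]
        refine Nat.le_zero.1 (Nat.sInf_le ⟨Finsupp.single 0 N, ?_, by simp, ?_⟩)
        · rwa [X_pow_eq_monomial] at hN
        · exact Finsupp.single_eq_of_ne (by rintro rfl; simp at hj)
      · exact hb0 j hj N
    · by_cases hj : j = 1 ∨ j = 2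
      · rw [hAss]
        rcases hj with rfl | rfl <;> simp
      · exact absurd (hb0 j hj a) hja
    · ext f
      rw [mem_restrictSupportIdeal_iff, hI.mem_iff]
      refine forall₂_congr fun e _ => ⟨fun he j => ?_, fun he => ?_⟩
      · by_cases hj : j = 1 ∨ j = 2
        · rw [hbj j hj]
          exact Nat.sInf_le ⟨e, he, rfl, rfl⟩
        · rw [hb0 j hj]
          exact Nat.zero_le _
      · have he1 := he 1
        have he2 := he 2
        rw [hbj 1 (Or.inl rfl)] at he1
        rw [hbj 2 (Or.inr rfl)] at he2
        obtain ⟨p, hp, hp0, hp1⟩ := Nat.sInf_mem (hV 1 (e 0))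
        obtain ⟨q, hq, hq0, hq2⟩ := Nat.sInf_mem (hV 2 (e 0))
        exact monomial_mem_of_associatedPrimes hAss hp hq hp0 hq0 (hp1.trans_le he1)
          (hq2.trans_le he2)
  obtain ⟨r, F, P, hF, hP⟩ := hfilt.exists_isPrimeFiltration fun P hP => hP.isPrime
  exact ⟨r, F, P, hF, fun i => hmin _ (hP i)⟩
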